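/- Let n = 2^m with m ≥ 1, let A be an array of n integers, let γ ∈ ℤ ∪ {−∞}, and let k ≥ 2 be an integer. Then F_k({1,…,n}, γ) equals the minimum, over all t ∈ {0,…,m−1} and k' ∈ {1,…,2^t}, of the minimum of A_{i_k} over all tuples i_1 < i_2 < … < i_k of indices in C(t,k') with γ < A_{i_1} < A_{i_2} < … < A_{i_k}, i_1 ∈ L(t,k'), and i_k ∈ R(t,k') (each inner minimum taken to be +∞ if no such tuple exists). -/

import Mathlib

/-- The dyadic interval `C(t,k') = {(k'−1)·2^m/2^t + 1, …, k'·2^m/2^t}`. -/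
def dyC (m t k' : ℕ) : Set ℕ :=
  Set.Icc ((k' - 1) * 2 ^ m / 2 ^ t + 1) (k' * 2 ^ m / 2 ^ t)

/-- The left half `L(t,k')` of the dyadic interval `C(t,k')` of `{1,…,2^m}`. -/
def dyL (m t k' : ℕ) : Set ℕ :=
  Set.Icc ((k' - 1) * 2 ^ m / 2 ^ t + 1) ((2 * k' - 1) * 2 ^ m / 2 ^ (t + 1))

/-- The right half `R(t,k')` of the dyadic interval `C(t,k')` of `{1,…,2^m}`. -/
def dyR (m t k' : ℕ) : Set ℕ :=
  Set.Icc ((2 * k' - 1) * 2 ^ m / 2 ^ (t + 1) + 1) (k' * 2 ^ m / 2 ^ t)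

/-- `F_k(S, γ)`: the minimum of `A_{i_k}` over all tuples `i_1 < … < i_k` of
indices in `S` with `γ < A_{i_1} < … < A_{i_k}` (`+∞` if no such tuple exists).
The threshold `γ` lives in `ℤ ∪ {−∞, +∞}` (encoded as `WithBot (WithTop ℤ)`). -/
noncomputable def Fmin (A : ℕ → ℤ) (S : Set ℕ) (k : ℕ) (γ : WithBot (WithTop ℤ)) :
    WithTop ℤ :=
  sInf {z : WithTop ℤ | ∃ hk : 0 < k, ∃ i : Fin k → ℕ, StrictMono i ∧
    (∀ a, i a ∈ S) ∧ (∀ a b : Fin k, a < b → A (i a) < A (i b)) ∧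
    γ < ((A (i ⟨0, hk⟩) : WithTop ℤ) : WithBot (WithTop ℤ)) ∧
    z = (A (i ⟨k - 1, by omega⟩) : WithTop ℤ)}

/-- Two distinct elements of `{c·2^m + 1, …, (c+1)·2^m}` are separated by the midpoint of a
dyadic interval. -/
theorem exists_dyadic_separation (m c a b : ℕ) (ha : c * 2 ^ m < a) (hab : a < b)
    (hb : b ≤ (c + 1) * 2 ^ m) :
    ∃ u p : ℕ, u < m ∧ p * (2 * 2 ^ u) < a ∧ a ≤ (2 * p + 1) * 2 ^ u ∧
      (2 * p + 1) * 2 ^ u < b ∧ b ≤ (p + 1) * (2 * 2 ^ u) := by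
  induction m generalizing c with
  | zero => simp only [pow_zero, mul_one] at ha hb; omega
  | succ m ih =>
    rw [pow_succ'] at ha hb
    by_cases h1 : b ≤ (2 * c + 1) * 2 ^ m
    · obtain ⟨u, p, hu, h⟩ := ih (2 * c) (by linarith) h1
      exact ⟨u, p, hu.trans m.lt_succ_self, h⟩
    by_cases h2 : a ≤ (2 * c + 1) * 2 ^ m
    · exact ⟨m, c, m.lt_succ_self, ha, h2, not_le.1 h1, hb⟩
    · obtain ⟨u, p, hu, h⟩ := ih (2 * c + 1) (not_le.1 h2) (by linarith)
      exact ⟨u, p, hu.trans m.lt_succ_self, h⟩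

theorem mul_two_pow_div (x t s : ℕ) : x * 2 ^ (t + s) / 2 ^ t = x * 2 ^ s := by
  rw [pow_add, mul_left_comm, Nat.mul_div_cancel_left _ (by positivity)]

theorem dyC_subset (m t k' : ℕ) (hk' : k' ≤ 2 ^ t) : dyC m t k' ⊆ Set.Icc 1 (2 ^ m) := by
  rintro x ⟨h1, h2⟩
  refine ⟨(Nat.le_add_left _ _).trans h1, h2.trans (Nat.div_le_of_le_mul ?_)⟩
  gcongr

theorem exists_mem_dyL_dyR (m a b : ℕ) (ha : 1 ≤ a) (hab : a < b) (hb : b ≤ 2 ^ m) :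
    ∃ t k' : ℕ, t ≤ m - 1 ∧ 1 ≤ k' ∧ k' ≤ 2 ^ t ∧ a ∈ dyL m t k' ∧ b ∈ dyR m t k' := by
  obtain ⟨u, p, hu, h1, h2, h3, h4⟩ :=
    exists_dyadic_separation m 0 a b (by omega) hab (by omega)
  obtain ⟨t, rfl⟩ : ∃ t, m = t + (u + 1) := ⟨m - (u + 1), by omega⟩
  have hmid : (2 * (p + 1) - 1) * 2 ^ (t + (u + 1)) / 2 ^ (t + 1) = (2 * p + 1) * 2 ^ u := by
    rw [show t + (u + 1) = t + 1 + u by omega, mul_two_pow_div]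
    rfl
  refine ⟨t, p + 1, by omega, by omega, ?_, ?_, ?_⟩
  · by_contra! h
    have : 2 ^ t * (2 * 2 ^ u) ≤ p * (2 * 2 ^ u) := Nat.mul_le_mul_right _ (by omega)
    rw [pow_add, pow_succ'] at hb
    omega
  · rw [dyL, hmid, mul_two_pow_div, pow_succ']
    exact ⟨h1, h2⟩
  · rw [dyR, hmid, mul_two_pow_div, pow_succ']
    exact ⟨h3, h4⟩

/-- `F_k({1,…,2^m}, γ)` equals the minimum over all dyadic
pieces `(t, k')` of the minimum of `A_{i_k}` over increasing tuples inside
`C(t,k')` with `γ < A_{i_1} < … < A_{i_k}`, `i_1 ∈ L(t,k')`, `i_k ∈ R(t,k')`. -/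
theorem stmt19 (m : ℕ) (hm : 1 ≤ m) (A : ℕ → ℤ) (γ : WithBot ℤ)
    (k : ℕ) (hk : 2 ≤ k) :
    Fmin A (Set.Icc 1 (2 ^ m)) k (γ.map (fun x : ℤ => (x : WithTop ℤ))) =
      sInf {z : WithTop ℤ | ∃ t k' : ℕ, t ≤ m - 1 ∧ 1 ≤ k' ∧ k' ≤ 2 ^ t ∧
        z = sInf {w : WithTop ℤ | ∃ i : Fin k → ℕ, StrictMono i ∧
          (∀ a, i a ∈ dyC m t k') ∧
          (∀ a b : Fin k, a < b → A (i a) < A (i b)) ∧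
          γ.map (fun x : ℤ => (x : WithTop ℤ)) <
            ((A (i ⟨0, by omega⟩) : WithTop ℤ) : WithBot (WithTop ℤ)) ∧
          i ⟨0, by omega⟩ ∈ dyL m t k' ∧ i ⟨k - 1, by omega⟩ ∈ dyR m t k' ∧
          w = (A (i ⟨k - 1, by omega⟩) : WithTop ℤ)}} := by
  have hbdd : BddBelow ((fun j => (A j : WithTop ℤ)) '' Set.Icc 1 (2 ^ m)) :=
    ((Set.finite_Icc 1 (2 ^ m)).image _).bddBelow
  obtain ⟨B, hB⟩ := hbdd
  set c : WithBot (WithTop ℤ) := γ.map (fun x : ℤ => (x : WithTop ℤ))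
  refine IsGLB.unique (WithTop.isGLB_sInf' ⟨B, ?_⟩) ?_
  · rintro z ⟨_, i, -, hi, -, -, rfl⟩
    exact hB ⟨_, hi _, rfl⟩
  have hinner (t k' : ℕ) (hk' : k' ≤ 2 ^ t) :=
    WithTop.isGLB_sInf' (s := {w : WithTop ℤ | ∃ i : Fin k → ℕ, StrictMono i ∧
          (∀ a, i a ∈ dyC m t k') ∧
          (∀ a b : Fin k, a < b → A (i a) < A (i b)) ∧
          c < ((A (i ⟨0, by omega⟩) : WithTop ℤ) : WithBot (WithTop ℤ)) ∧
          i ⟨0, by omega⟩ ∈ dyL m t k' ∧ i ⟨k - 1, by omega⟩ ∈ dyR m t k' ∧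
          w = (A (i ⟨k - 1, by omega⟩) : WithTop ℤ)}) ⟨B, by
      rintro z ⟨i, -, hi, -, -, -, -, rfl⟩
      exact hB ⟨_, dyC_subset m t k' hk' (hi _), rfl⟩⟩
  have houter := WithTop.isGLB_sInf' (s := {z : WithTop ℤ | ∃ t k' : ℕ, t ≤ m - 1 ∧ 1 ≤ k' ∧
        k' ≤ 2 ^ t ∧ z = sInf {w : WithTop ℤ | ∃ i : Fin k → ℕ, StrictMono i ∧
          (∀ a, i a ∈ dyC m t k') ∧
          (∀ a b : Fin k, a < b → A (i a) < A (i b)) ∧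
          c < ((A (i ⟨0, by omega⟩) : WithTop ℤ) : WithBot (WithTop ℤ)) ∧
          i ⟨0, by omega⟩ ∈ dyL m t k' ∧ i ⟨k - 1, by omega⟩ ∈ dyR m t k' ∧
          w = (A (i ⟨k - 1, by omega⟩) : WithTop ℤ)}}) ⟨B, by
      rintro z ⟨t, k', -, -, hk', rfl⟩
      refine (hinner t k' hk').2 ?_
      rintro z ⟨i, -, hi, -, -, -, -, rfl⟩
      exact hB ⟨_, dyC_subset m t k' hk' (hi _), rfl⟩⟩
  constructor
  · rintro z ⟨_, i, hmono, hi, hA, hc, rfl⟩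
    obtain ⟨t, k', ht, hk1, hk', hL, hR⟩ := exists_mem_dyL_dyR m (i ⟨0, by omega⟩)
      (i ⟨k - 1, by omega⟩) (hi _).1 (hmono (Fin.mk_lt_mk.2 (by omega))) (hi _).2
    refine (houter.1 ⟨t, k', ht, hk1, hk', rfl⟩).trans ((hinner t k' hk').1
      ⟨i, hmono, fun a => ⟨hL.1.trans (hmono.monotone ?_), (hmono.monotone ?_).trans hR.2⟩,
        hA, hc, hL, hR, rfl⟩)
    · exact Fin.mk_le_mk.2 (Nat.zero_le _)
    · exact Fin.mk_le_mk.2 (by omega)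
  · intro b hb
    refine houter.2 ?_
    rintro z ⟨t, k', -, -, hk', rfl⟩
    refine (hinner t k' hk').2 ?_
    rintro z ⟨i, hmono, hi, hA, hc, -, -, rfl⟩
    exact hb ⟨by omega, i, hmono, fun a => dyC_subset m t k' hk' (hi a), hA, hc, rfl⟩
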